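/- arXiv:1410.0417 — 2 statements merged into one kernel-verified Lean document; each statement's English description precedes it below -/
import Mathlib

section
/- Let S_K° := ⋃_{M ∈ SL₂(O_K)} (M(ℝ̂) ∩ ℂ) ⊆ ℂ be the (finite part of the) Schmidt arrangement of K. Then S_K° is a connected subset of ℂ if and only if Δ ∈ {−3, −4, −7, −8, −11}, i.e. if and only if O_K is a Euclidean domain. -/
open Complex ComplexConjugate NumberField

/-- The finite part of the Möbius image of the extended real line `ℝ̂` under the matrix
`[[α,γ],[β,δ]]`: the set `{(αx+γ)/(βx+δ) : x ∈ ℝ, βx+δ ≠ 0} ∪ {α/β if β ≠ 0}`. -/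
def mobiusFin (α β γ δ : ℂ) : Set ℂ :=
  {z | (∃ x : ℝ, β * (x : ℂ) + δ ≠ 0 ∧ z = (α * x + γ) / (β * x + δ)) ∨ (β ≠ 0 ∧ z = α / β)}

/-- The embedding of the ring of integers of `K` into `ℂ` induced by `ι : K →+* ℂ`. -/
noncomputable def emb (K : Type) [Field K] [NumberField K] (ι : K →+* ℂ)
    (x : RingOfIntegers K) : ℂ := ι (algebraMap (RingOfIntegers K) K x)

/-- The finite part `S_K° ⊆ ℂ` of the Schmidt arrangement of `K`: the union over
`M ∈ SL₂(O_K)` of the finite parts of the Möbius images `M(ℝ̂)`. -/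
noncomputable def schmidtFin (K : Type) [Field K] [NumberField K] (ι : K →+* ℂ) : Set ℂ :=
  ⋃ M : Matrix.SpecialLinearGroup (Fin 2) (RingOfIntegers K),
    mobiusFin (emb K ι (M.1 0 0)) (emb K ι (M.1 1 0)) (emb K ι (M.1 0 1)) (emb K ι (M.1 1 1))

theorem isCoprime_repr_one {K : Type*} [Field K] [NumberField K]
    (b : Module.Basis (Fin 2) ℤ (𝓞 K)) : IsCoprime (b.repr 1 0) (b.repr 1 1) := by
  rw [Int.isCoprime_iff_gcd_eq_one]
  obtain ⟨m, hm⟩ := Int.gcd_dvd_left (b.repr 1 0) (b.repr 1 1)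
  obtain ⟨n, hn⟩ := Int.gcd_dvd_right (b.repr 1 0) (b.repr 1 1)
  set d : ℤ := ((b.repr 1 0).gcd (b.repr 1 1) : ℤ) with hd
  have hone : (1 : 𝓞 K) = algebraMap ℤ (𝓞 K) d * (m • b 0 + n • b 1) := by
    conv_lhs => rw [← b.sum_repr 1, Fin.sum_univ_two, hm, hn]
    simp only [zsmul_eq_mul, algebraMap_int_eq, eq_intCast]
    push_cast
    ring
  have hunit : IsUnit (algebraMap ℤ (𝓞 K) d) := IsUnit.of_mul_eq_one _ hone.symm
  have hnorm := hunit.map (Algebra.norm ℤ)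
  rw [Algebra.norm_algebraMap_of_basis b, Fintype.card_fin, isUnit_pow_iff two_ne_zero,
    Int.isUnit_iff] at hnorm
  omega

/-- The ring of integers of a quadratic field has a `ℤ`-basis containing `1`. -/
theorem exists_basis_one {K : Type*} [Field K] [NumberField K]
    (hdeg : Module.finrank ℚ K = 2) :
    ∃ b : Module.Basis (Fin 2) ℤ (𝓞 K), b 0 = 1 := by
  have hrank : Module.finrank ℤ (𝓞 K) = 2 := by rw [RingOfIntegers.rank, hdeg]
  let b := Module.finBasisOfFinrankEq ℤ (𝓞 K) hrank
  obtain ⟨u, v, huv⟩ := isCoprime_repr_one b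
  have hone : (1 : 𝓞 K) = (b.repr 1 0 : 𝓞 K) * b 0 + (b.repr 1 1 : 𝓞 K) * b 1 := by
    conv_lhs => rw [← b.sum_repr 1, Fin.sum_univ_two]
    simp only [zsmul_eq_mul]
  set m := b.repr 1 0
  set n := b.repr 1 1
  have huv' : (u : 𝓞 K) * m + v * n = 1 := by exact_mod_cast huv
  have hspan : (⊤ : Submodule ℤ (𝓞 K)) ≤
      Submodule.span ℤ (Set.range ![1, -v • b 0 + u • b 1]) := by
    rw [← b.span_eq, Submodule.span_le]
    rintro _ ⟨i, rfl⟩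
    rw [SetLike.mem_coe, Matrix.range_cons, Matrix.range_cons, Matrix.range_empty,
      Set.union_empty, Set.singleton_union, Submodule.mem_span_pair]
    fin_cases i
    · refine ⟨u, -n, ?_⟩
      simp only [zsmul_eq_mul, Fin.zero_eta]
      push_cast
      linear_combination (u : 𝓞 K) * hone + b 0 * huv'
    · refine ⟨v, m, ?_⟩
      simp only [zsmul_eq_mul, Fin.mk_one]
      push_cast
      linear_combination (v : 𝓞 K) * hone + b 1 * huv'
  exact ⟨basisOfTopLeSpanOfCardEqFinrank _ hspan (by simp [hrank]), by simp⟩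

theorem discr_eq_of_basis_one {K : Type*} [Field K] [NumberField K]
    (b : Module.Basis (Fin 2) ℤ (𝓞 K)) (hb : b 0 = 1) {t n : ℤ}
    (hω : b 1 * b 1 = t * b 1 - n) : discr K = t ^ 2 - 4 * n := by
  have hrepr : b.repr (b 1 * b 1) = Finsupp.single 0 (-n) + Finsupp.single 1 t := by
    apply b.repr.symm.injective
    rw [LinearEquiv.symm_apply_apply, map_add]
    simp only [Module.Basis.repr_symm_single, zsmul_eq_mul, hb, hω]
    push_cast
    ring
  have htr_one : Algebra.trace ℤ (𝓞 K) 1 = 2 := by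
    rw [Algebra.trace_eq_matrix_trace b]
    simp
  have htr : Algebra.trace ℤ (𝓞 K) (b 1) = t := by
    rw [Algebra.trace_eq_matrix_trace b, Matrix.trace_fin_two, Algebra.leftMulMatrix_eq_repr_mul,
      Algebra.leftMulMatrix_eq_repr_mul, hrepr, hb, mul_one]
    simp
  have htr_sq : Algebra.trace ℤ (𝓞 K) (b 1 * b 1) = t ^ 2 - 2 * n := by
    have h : b 1 * b 1 = t • b 1 - n • (1 : 𝓞 K) := by simp [hω]
    rw [h, map_sub, map_smul, map_smul, htr, htr_one]
    simp only [smul_eq_mul]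
    ring
  rw [← discr_eq_discr K b, Algebra.discr_def, Matrix.det_fin_two]
  simp only [Algebra.traceMatrix_apply, Algebra.traceForm_apply, hb, one_mul, mul_one, htr,
    htr_one, htr_sq]
  ring

/-- The ring of integers of a quadratic field is `ℤ[ω]` with `ω² = e ω - N` and `e ∈ {0, 1}`. -/
theorem exists_integral_generator {K : Type*} [Field K] [NumberField K]
    (hdeg : Module.finrank ℚ K = 2) :
    ∃ (ω : 𝓞 K) (e N : ℤ), (e = 0 ∨ e = 1) ∧ ω * ω = e * ω - N ∧ discr K = e - 4 * N ∧
      ∀ x : 𝓞 K, ∃ a b : ℤ, x = a + b * ω := by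
  obtain ⟨b, hb⟩ := exists_basis_one hdeg
  have hrepr (x : 𝓞 K) : x = b.repr x 0 + b.repr x 1 * b 1 := by
    conv_lhs => rw [← b.sum_repr x, Fin.sum_univ_two, hb]
    simp
  obtain ⟨t, n, hω⟩ : ∃ t n : ℤ, b 1 * b 1 = t * b 1 - n :=
    ⟨b.repr (b 1 * b 1) 1, -b.repr (b 1 * b 1) 0, by
      push_cast
      linear_combination hrepr (b 1 * b 1)⟩
  have hdiscr := discr_eq_of_basis_one b hb hω
  obtain ⟨k, e, he, rfl⟩ : ∃ k e : ℤ, (e = 0 ∨ e = 1) ∧ t = 2 * k + e :=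
    ⟨t / 2, t % 2, by omega, by omega⟩
  refine ⟨b 1 - k, e, n - k ^ 2 - e * k, he, ?_, ?_, fun x => ?_⟩
  · push_cast at hω ⊢
    linear_combination hω
  · rw [hdiscr]
    rcases he with rfl | rfl <;> ring
  · refine ⟨b.repr x 0 + b.repr x 1 * k, b.repr x 1, ?_⟩
    push_cast
    linear_combination hrepr x

theorem mem_mobiusFin_iff {α β γ δ : ℂ} (hdet : α * δ - β * γ = 1) (z : ℂ) :
    z ∈ mobiusFin α β γ δ ↔ ((δ * z - γ) * conj (α - β * z)).im = 0 := by
  constructor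
  · rintro (⟨x, hx, rfl⟩ | ⟨hβ, rfl⟩)
    · have h₁ : δ * ((α * x + γ) / (β * x + δ)) - γ = x * (β * x + δ)⁻¹ := by
        rw [← div_eq_mul_inv, mul_div_assoc', div_sub' hx, div_left_inj' hx]
        linear_combination (x : ℂ) * hdet
      have h₂ : α - β * ((α * x + γ) / (β * x + δ)) = (β * x + δ)⁻¹ := by
        field_simp
        linear_combination hdet
      rw [h₁, h₂, mul_assoc, mul_conj, ← ofReal_mul, ofReal_im]
    · rw [mul_div_cancel₀ _ hβ]
      simp
  · intro h
    by_cases hz : α - β * z = 0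
    · have hβ : β ≠ 0 := by
        rintro rfl
        have hα : α = 0 := by simpa using hz
        simp [hα] at hdet
      refine Or.inr ⟨hβ, ?_⟩
      rw [eq_div_iff hβ]
      linear_combination -hz
    · obtain ⟨x, hx⟩ : ∃ x : ℝ, (x : ℂ) = (δ * z - γ) / (α - β * z) := by
        refine ⟨((δ * z - γ) * conj (α - β * z)).re / normSq (α - β * z), ?_⟩
        have hre : ((((δ * z - γ) * conj (α - β * z)).re : ℝ) : ℂ) =
            (δ * z - γ) * conj (α - β * z) := Complex.ext (by simp) (by rw [ofReal_im, h])
        rw [ofReal_div, hre, ← mul_conj,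
          mul_div_mul_right _ _ ((map_ne_zero (starRingEnd ℂ)).mpr hz)]
      have hden : β * x + δ = (α - β * z)⁻¹ := by
        rw [hx]
        field_simp
        linear_combination hdet
      refine Or.inl ⟨x, by rw [hden]; exact inv_ne_zero hz, ?_⟩
      rw [eq_div_iff hz] at hx
      rw [hden, div_inv_eq_mul]
      linear_combination -z * hdet - α * hx

/-- The finite part of the Möbius image of the real line is the zero set of an equation of a
circle or a line. -/
theorem mem_mobiusFin_iff_circle {α β γ δ : ℂ} (hdet : α * δ - β * γ = 1) (z : ℂ) :
    z ∈ mobiusFin α β γ δ ↔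
      -2 * (δ * conj β).im * (z.re ^ 2 + z.im ^ 2)
        + 2 * ((δ * conj α - β * conj γ).im * z.re + (δ * conj α - β * conj γ).re * z.im)
        + -2 * (γ * conj α).im = 0 := by
  rw [mem_mobiusFin_iff hdet, ← mul_eq_zero_iff_left (two_ne_zero (α := ℝ))]
  simp only [mul_im, mul_re, sub_im, sub_re, conj_re, conj_im]
  ring_nf

theorem circle_discr_eq_one {α β γ δ : ℂ} (hdet : α * δ - β * γ = 1) :
    (δ * conj α - β * conj γ).im ^ 2 + (δ * conj α - β * conj γ).re ^ 2
      - -2 * (δ * conj β).im * (-2 * (γ * conj α).im) = 1 := by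
  have hre := congrArg re hdet
  have him := congrArg im hdet
  simp only [mul_im, mul_re, sub_im, sub_re, one_re, one_im, conj_re, conj_im] at *
  linear_combination
    (α.re * δ.re - α.im * δ.im - (β.re * γ.re - β.im * γ.im) + 1) * hre
      + (α.re * δ.im + α.im * δ.re - (β.re * γ.im + β.im * γ.re)) * him

theorem isPreconnected_circle {A p q C : ℝ} (hdiscr : p ^ 2 + q ^ 2 - A * C = 1) :
    IsPreconnected {z : ℂ | A * (z.re ^ 2 + z.im ^ 2) + 2 * (p * z.re + q * z.im) + C = 0} := by
  rcases eq_or_ne A 0 with rfl | hA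
  · apply Convex.isPreconnected
    intro z hz z' hz' a b _ _ hab
    simp only [Set.mem_ofPred_eq, add_re, add_im, real_smul, re_ofReal_mul, im_ofReal_mul] at *
    linear_combination a * hz + b * hz' - C * hab
  · have hsphere : {z : ℂ | A * (z.re ^ 2 + z.im ^ 2) + 2 * (p * z.re + q * z.im) + C = 0} =
        Metric.sphere (⟨-p / A, -q / A⟩ : ℂ) |A|⁻¹ := by
      ext z
      have hsq : ‖z - ⟨-p / A, -q / A⟩‖ = |A|⁻¹ ↔
          (z.re + p / A) ^ 2 + (z.im + q / A) ^ 2 = (A ^ 2)⁻¹ := by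
        rw [← sq_eq_sq₀ (norm_nonneg _) (by positivity), Complex.sq_norm, normSq_apply, inv_pow, sq_abs,
          sub_re, sub_im]
        ring_nf
      rw [mem_sphere_iff_norm, hsq, Set.mem_ofPred_eq]
      field_simp
      constructor <;> intro h
      · linear_combination A * h + hdiscr
      · apply mul_left_cancel₀ hA
        linear_combination h - hdiscr
    rw [hsphere]
    exact isPreconnected_sphere (by simp [Complex.rank_real_complex]) _ _

theorem isPreconnected_mobiusFin {α β γ δ : ℂ} (hdet : α * δ - β * γ = 1) :
    IsPreconnected (mobiusFin α β γ δ) := by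
  convert isPreconnected_circle (circle_discr_eq_one hdet) using 1
  ext z
  exact mem_mobiusFin_iff_circle hdet z

/-- If a circle of discriminant one meets the circle with centre `(g, h)` orthogonal to the unit
circle, then the normalised inner product of the two circles is at most one in absolute value. -/
theorem sq_inner_le_of_circles_meet {A p q C g h x y : ℝ} (hdiscr : p ^ 2 + q ^ 2 - A * C = 1)
    (hcircle : A * (x ^ 2 + y ^ 2) + 2 * (p * x + q * y) + C = 0)
    (hghost : (x - g) ^ 2 + (y - h) ^ 2 = g ^ 2 + h ^ 2 - 1) :
    (p * g + q * h + (A + C) / 2) ^ 2 ≤ g ^ 2 + h ^ 2 - 1 := by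
  have hinner : (A * g + p) * (x - g) + (A * h + q) * (y - h) =
      -(A * (g ^ 2 + h ^ 2 - 1) + (p * g + q * h + (A + C) / 2)) := by
    linear_combination hcircle / 2 - A / 2 * hghost
  have hsq : ((A * g + p) * (y - h) - (A * h + q) * (x - g)) ^ 2 =
      g ^ 2 + h ^ 2 - 1 - (p * g + q * h + (A + C) / 2) ^ 2 := by
    linear_combination ((A * g + p) ^ 2 + (A * h + q) ^ 2) * hghost
      - ((A * g + p) * (x - g) + (A * h + q) * (y - h)
        - (A * (g ^ 2 + h ^ 2 - 1) + (p * g + q * h + (A + C) / 2))) * hinner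
      + (g ^ 2 + h ^ 2 - 1) * hdiscr
  nlinarith [sq_nonneg ((A * g + p) * (y - h) - (A * h + q) * (x - g))]

theorem generator_re_im {w : ℂ} {e N : ℤ} (he : e = 0 ∨ e = 1) (hw : w * w = e * w - N)
    (hpos : 0 < 4 * N - e) : w.re = e / 2 ∧ 4 * w.im ^ 2 = 4 * N - e := by
  have hre := congrArg re hw
  have him := congrArg im hw
  simp only [mul_re, mul_im, sub_re, sub_im, intCast_re, intCast_im] at hre him
  have hpos' : (0 : ℝ) < 4 * N - e := by exact_mod_cast hpos
  have he' : (e : ℝ) ^ 2 = e := by rcases he with rfl | rfl <;> simp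
  have hs : w.im ≠ 0 := by
    intro h
    rw [h] at hre
    nlinarith [sq_nonneg (2 * w.re - e)]
  have hw_re : w.re = e / 2 := by
    apply mul_right_cancel₀ hs
    linear_combination him / 2
  refine ⟨hw_re, ?_⟩
  rw [hw_re] at hre
  linear_combination -4 * hre - he'

section Schmidt

variable {K : Type} [Field K] [NumberField K] {ι : K →+* ℂ}

theorem emb_injective : Function.Injective (emb K ι) :=
  ι.injective.comp RingOfIntegers.coe_injective

theorem emb_ne_zero {x : 𝓞 K} (hx : x ≠ 0) : emb K ι x ≠ 0 := fun h =>
  hx (emb_injective (h.trans (by simp [emb])))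

theorem emb_det {α β γ δ : 𝓞 K} (hdet : α * δ - β * γ = 1) :
    emb K ι α * emb K ι δ - emb K ι β * emb K ι γ = 1 := by
  have h := congrArg (emb K ι) hdet
  simpa [emb] using h

theorem mem_schmidtFin_iff {z : ℂ} :
    z ∈ schmidtFin K ι ↔ ∃ α β γ δ : 𝓞 K, α * δ - β * γ = 1 ∧
      z ∈ mobiusFin (emb K ι α) (emb K ι β) (emb K ι γ) (emb K ι δ) := by
  rw [schmidtFin, Set.mem_iUnion]
  constructor
  · rintro ⟨M, hM⟩
    refine ⟨_, _, _, _, ?_, hM⟩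
    rw [mul_comm (M.1 1 0), ← Matrix.det_fin_two, M.2]
  · rintro ⟨α, β, γ, δ, hdet, hz⟩
    exact ⟨⟨!![α, γ; β, δ], by rw [Matrix.det_fin_two_of]; linear_combination hdet⟩, by simpa⟩

theorem emb_generator {ω : 𝓞 K} {e N : ℤ} (hω : ω * ω = e * ω - N) :
    emb K ι ω * emb K ι ω = e * emb K ι ω - N := by
  have h := congrArg (emb K ι) hω
  simpa [emb] using h

theorem emb_add_mul (a b : ℤ) (ω : 𝓞 K) : emb K ι (a + b * ω) = a + b * emb K ι ω := by
  simp [emb]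

/-- The ring of integers is relatively dense in `ℂ`, with the bound coming from the rectangular
fundamental domain. -/
theorem exists_normSq_sub_emb_le {ω : 𝓞 K} (hs : (emb K ι ω).im ≠ 0) (z : ℂ) :
    ∃ κ : 𝓞 K, normSq (z - emb K ι κ) ≤ (1 + (emb K ι ω).im ^ 2) / 4 := by
  set w := emb K ι ω with hw
  refine ⟨((round (z.re - round (z.im / w.im) * w.re) : ℤ) : 𝓞 K) +
    (round (z.im / w.im) : ℤ) * ω, ?_⟩
  rw [emb_add_mul, ← hw]
  set n := round (z.im / w.im)
  have hre := abs_sub_round (z.re - n * w.re)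
  have him : |z.im / w.im - n| ≤ 1 / 2 := abs_sub_round (z.im / w.im)
  set m := round (z.re - n * w.re)
  have hre' : (z - (m + n * w)).re = z.re - n * w.re - m := by simp; ring
  have him' : (z - (m + n * w)).im = (z.im / w.im - n) * w.im := by
    simp [sub_mul, div_mul_cancel₀ _ hs]
  rw [normSq_apply, hre', him']
  have h₁ := sq_le_sq' (abs_le.mp hre).1 (abs_le.mp hre).2
  have h₂ := sq_le_sq' (abs_le.mp him).1 (abs_le.mp him).2
  nlinarith [mul_le_mul_of_nonneg_right h₂ (sq_nonneg w.im)]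

/-- The circle orthogonal to the unit circle with centre `1/2 + i (2N - e) / (4 Im ω)` does not
meet the Schmidt arrangement. -/
theorem not_mem_ghost_of_mem_schmidtFin {ω : 𝓞 K} {e N : ℤ} (he : e = 0 ∨ e = 1)
    (hω : ω * ω = e * ω - N) (hpos : 0 < 4 * N - e)
    (hgen : ∀ x : 𝓞 K, ∃ a b : ℤ, x = a + b * ω) {h : ℝ}
    (hh : 4 * (emb K ι ω).im * h = 2 * N - e) {z : ℂ} (hz : z ∈ schmidtFin K ι) :
    (z.re - 1 / 2) ^ 2 + (z.im - h) ^ 2 ≠ (1 / 2) ^ 2 + h ^ 2 - 1 := by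
  intro hghost
  obtain ⟨hre, him⟩ := generator_re_im he (emb_generator (ι := ι) hω) hpos
  obtain ⟨α, β, γ, δ, hdet, hz⟩ := mem_schmidtFin_iff.mp hz
  replace hdet := emb_det (ι := ι) hdet
  have hle := sq_inner_le_of_circles_meet (circle_discr_eq_one hdet)
    ((mem_mobiusFin_iff_circle hdet z).mp hz) hghost
  obtain ⟨a₁, a₂, rfl⟩ := hgen α
  obtain ⟨b₁, b₂, rfl⟩ := hgen β
  obtain ⟨c₁, c₂, rfl⟩ := hgen γ
  obtain ⟨d₁, d₂, rfl⟩ := hgen δ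
  simp only [emb_add_mul] at hdet hle
  set w := emb K ι ω
  have hdet_re := congrArg re hdet
  have hdet_im := congrArg im hdet
  simp only [mul_re, mul_im, sub_re, sub_im, add_re, add_im, intCast_re, intCast_im, one_re,
    one_im, hre] at hdet_re hdet_im
  have hA : ((d₁ + d₂ * w) * conj (b₁ + b₂ * w)).im = w.im * (d₂ * b₁ - d₁ * b₂) := by
    simp only [mul_im, add_re, add_im, mul_re, intCast_re, intCast_im, conj_re, conj_im]
    ring
  have hC : ((c₁ + c₂ * w) * conj (a₁ + a₂ * w)).im = w.im * (c₂ * a₁ - c₁ * a₂) := by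
    simp only [mul_im, add_re, add_im, mul_re, intCast_re, intCast_im, conj_re, conj_im]
    ring
  have hp : ((d₁ + d₂ * w) * conj (a₁ + a₂ * w) - (b₁ + b₂ * w) * conj (c₁ + c₂ * w)).im =
      w.im * (2 * (c₂ * b₁ - a₂ * d₁) + e * (c₂ * b₂ - a₂ * d₂)) := by
    simp only [mul_im, sub_im, add_re, add_im, mul_re, intCast_re, intCast_im, conj_re, conj_im,
      hre]
    linear_combination hdet_im
  have hq : ((d₁ + d₂ * w) * conj (a₁ + a₂ * w) - (b₁ + b₂ * w) * conj (c₁ + c₂ * w)).re =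
      1 - 2 * w.im ^ 2 * (c₂ * b₂ - a₂ * d₂) := by
    simp only [mul_im, sub_re, add_re, add_im, mul_re, intCast_re, intCast_im, conj_re, conj_im,
      hre]
    linear_combination hdet_re
  rw [hA, hC, hp, hq] at hle
  obtain ⟨j, hj⟩ : ∃ j : ℤ, (j : ℝ) = (N - e) * (c₂ * b₂ - a₂ * d₂) - (c₂ * b₁ - a₂ * d₁)
      + (d₂ * b₁ - d₁ * b₂) + (c₂ * a₁ - c₁ * a₂) :=
    ⟨(N - e) * (c₂ * b₂ - a₂ * d₂) - (c₂ * b₁ - a₂ * d₁)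
      + (d₂ * b₁ - d₁ * b₂) + (c₂ * a₁ - c₁ * a₂), by push_cast; ring⟩
  have hreal : ((4 * N - e) * j - (2 * N - e) : ℝ) ^ 2 ≤ (2 * N - e) ^ 2 - 3 * (4 * N - e) := by
    have hlhs : ((4 * N - e) * j - (2 * N - e) : ℝ) =
        -(4 * w.im * (w.im * (2 * (c₂ * b₁ - a₂ * d₁) + e * (c₂ * b₂ - a₂ * d₂)) * (1 / 2)
          + (1 - 2 * w.im ^ 2 * (c₂ * b₂ - a₂ * d₂)) * h
          + (-2 * (w.im * (d₂ * b₁ - d₁ * b₂)) + -2 * (w.im * (c₂ * a₁ - c₁ * a₂))) / 2)) := by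
      linear_combination (4 * N - e : ℝ) * hj + (1 - 2 * w.im ^ 2 * (c₂ * b₂ - a₂ * d₂)) * hh
        + (c₂ * b₁ - a₂ * d₁ + e * (c₂ * b₂ - a₂ * d₂) / 2
          - (2 * N - e) * (c₂ * b₂ - a₂ * d₂) / 2
          - (d₂ * b₁ - d₁ * b₂) - (c₂ * a₁ - c₁ * a₂)) * him
    have hrhs : ((2 * N - e) ^ 2 - 3 * (4 * N - e) : ℝ) =
        (4 * w.im) ^ 2 * ((1 / 2) ^ 2 + h ^ 2 - 1) := by
      linear_combination -(4 * w.im * h + 2 * N - e) * hh + 3 * him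
    rw [hlhs, hrhs, neg_sq, mul_pow]
    exact mul_le_mul_of_nonneg_left hle (by positivity)
  have hintegral : ((4 * N - e) * j - (2 * N - e)) ^ 2 ≤ (2 * N - e) ^ 2 - 3 * (4 * N - e) := by
    exact_mod_cast hreal
  have hprod : j * ((4 * N - e) * j - (4 * N - e) + e) ≤ -3 := by
    have he'' : e ^ 2 = e := by rcases he with rfl | rfl <;> simp
    by_contra! hlt
    nlinarith [mul_lt_mul_of_pos_left hlt hpos]
  rcases le_or_gt j 0 with hj₀ | hj₀
  · have : (4 * N - e) * j - (4 * N - e) + e ≤ 0 := by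
      rcases he with rfl | rfl <;> nlinarith
    nlinarith
  · have : 0 ≤ (4 * N - e) * j - (4 * N - e) + e := by
      rcases he with rfl | rfl <;> nlinarith
    nlinarith

theorem dense_schmidtFin {ω : 𝓞 K} (hs : (emb K ι ω).im ≠ 0) : Dense (schmidtFin K ι) := by
  rw [Metric.dense_iff]
  intro z r hr
  set c := (1 + (emb K ι ω).im ^ 2) / 4
  obtain ⟨n, hn⟩ := exists_nat_gt ((c + 2) / r)
  have hc : 0 < c := by positivity
  have hn₀ : (0 : ℝ) < n := lt_trans (by positivity) hn
  have hn₁ : (1 : ℝ) ≤ n := by exact_mod_cast hn₀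
  have hnC : (n : ℂ) ≠ 0 := by exact_mod_cast hn₀.ne'
  obtain ⟨κ, hκ⟩ := exists_normSq_sub_emb_le hs (n * z)
  refine ⟨emb K ι (1 + n * κ) / emb K ι (n ^ 2), ?_,
    mem_schmidtFin_iff.mpr ⟨1 + n * κ, n ^ 2, -κ ^ 2, 1 - n * κ, by ring, Or.inr ⟨?_, rfl⟩⟩⟩
  · have hκ' : ‖n * z - emb K ι κ‖ ≤ c + 1 := by
      rw [normSq_eq_norm_sq] at hκ
      change _ ≤ c at hκ
      nlinarith [norm_nonneg (n * z - emb K ι κ), sq_nonneg (‖n * z - emb K ι κ‖ - 1)]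
    have hpoint : emb K ι (1 + n * κ) / emb K ι (n ^ 2) - z =
        (n * (-(n * z - emb K ι κ)) + 1) / n ^ 2 := by
      have h₁ : emb K ι (1 + n * κ) = 1 + n * emb K ι κ := by simp [emb]
      have h₂ : emb K ι (n ^ 2) = (n : ℂ) ^ 2 := by simp [emb]
      rw [h₁, h₂]
      field_simp
      ring
    rw [Metric.mem_ball, dist_eq_norm, hpoint, norm_div, norm_pow, Complex.norm_natCast,
      div_lt_iff₀ (by positivity)]
    calc ‖(n : ℂ) * (-(n * z - emb K ι κ)) + 1‖
        ≤ n * ‖n * z - emb K ι κ‖ + 1 := by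
          refine (norm_add_le _ _).trans_eq ?_
          rw [norm_mul, norm_neg, Complex.norm_natCast, norm_one]
      _ ≤ n * (c + 2) := by nlinarith
      _ < r * n ^ 2 := by
          rw [div_lt_iff₀ hr] at hn
          nlinarith
  · have h : emb K ι (n ^ 2) = (n : ℂ) ^ 2 := by simp [emb]
    rw [h]
    exact pow_ne_zero 2 hnC

theorem zero_mem_schmidtFin : (0 : ℂ) ∈ schmidtFin K ι :=
  mem_schmidtFin_iff.mpr ⟨1, 0, 0, 1, by ring, Or.inl ⟨0, by simp [emb], by simp [emb]⟩⟩

theorem not_isPreconnected_schmidtFin {ω : 𝓞 K} {e N : ℤ} (he : e = 0 ∨ e = 1)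
    (hω : ω * ω = e * ω - N) (hgen : ∀ x : 𝓞 K, ∃ a b : ℤ, x = a + b * ω) (hN : 4 ≤ N) :
    ¬ IsPreconnected (schmidtFin K ι) := by
  intro hconn
  have hpos : 0 < 4 * N - e := by omega
  obtain ⟨-, him⟩ := generator_re_im he (emb_generator (ι := ι) hω) hpos
  have hpos' : (0 : ℝ) < 4 * N - e := by exact_mod_cast hpos
  have hs : (emb K ι ω).im ≠ 0 := by
    intro h
    rw [h] at him
    linarith
  obtain ⟨h, hh⟩ : ∃ h : ℝ, 4 * (emb K ι ω).im * h = 2 * N - e :=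
    ⟨(2 * N - e) / (4 * (emb K ι ω).im), by field_simp⟩
  have hghost (z : ℂ) (hz : z ∈ schmidtFin K ι) :=
    not_mem_ghost_of_mem_schmidtFin he hω hpos hgen hh hz
  have hrad : 0 < (1 / 2) ^ 2 + h ^ 2 - 1 := by
    have hNe : (0 : ℝ) < (2 * N - e) ^ 2 - 3 * (4 * N - e) := by
      have : 0 < (2 * N - e) ^ 2 - 3 * (4 * N - e) := by
        rcases he with rfl | rfl <;> nlinarith
      exact_mod_cast this
    have hrhs : ((2 * N - e) ^ 2 - 3 * (4 * N - e) : ℝ) =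
        (4 * (emb K ι ω).im) ^ 2 * ((1 / 2) ^ 2 + h ^ 2 - 1) := by
      linear_combination -(4 * (emb K ι ω).im * h + 2 * N - e) * hh + 3 * him
    rw [hrhs] at hNe
    exact pos_of_mul_pos_right hNe (sq_nonneg _)
  have hcont : Continuous fun z : ℂ => (z.re - 1 / 2) ^ 2 + (z.im - h) ^ 2 := by fun_prop
  have hinside := isOpen_lt hcont (continuous_const (y := (1 / 2) ^ 2 + h ^ 2 - 1))
  have houtside := isOpen_lt (continuous_const (y := (1 / 2) ^ 2 + h ^ 2 - 1)) hcont
  obtain ⟨z, hzin, hzS⟩ := (dense_schmidtFin hs).inter_open_nonempty _ hinside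
    ⟨⟨1 / 2, h⟩, by simpa using hrad⟩
  obtain ⟨z', -, hlt, hgt⟩ := hconn _ _ hinside houtside
    (fun z hz => lt_or_gt_of_ne (hghost z hz)) ⟨z, hzS, hzin⟩
    ⟨0, zero_mem_schmidtFin, by simp⟩
  rw [Set.mem_ofPred_eq] at hlt hgt
  exact lt_asymm hlt hgt

/-- The ring `ℤ[√-3]` is not integrally closed. -/
theorem false_of_generator_sq_eq_neg_three {ω : 𝓞 K} (hω : ω * ω = -3)
    (hs : (emb K ι ω).im ≠ 0) (hgen : ∀ x : 𝓞 K, ∃ a b : ℤ, x = a + b * ω) : False := by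
  set x := algebraMap (𝓞 K) K ω
  have hx_sq : x * x = -3 := by
    have h := congrArg (algebraMap (𝓞 K) K) hω
    rwa [map_mul, map_neg, map_ofNat] at h
  have hintegral : IsIntegral ℤ ((1 + x) / 2) := by
    refine ⟨Polynomial.X ^ 2 - Polynomial.X + 1, by monicity!, ?_⟩
    simp only [Polynomial.eval₂_add, Polynomial.eval₂_sub, Polynomial.eval₂_pow,
      Polynomial.eval₂_X, Polynomial.eval₂_one]
    linear_combination hx_sq / 4
  obtain ⟨a, b, hab⟩ := hgen ⟨_, hintegral⟩
  have hK : (1 + x) / 2 = a + b * x := by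
    have h := congrArg (algebraMap (𝓞 K) K) hab
    rwa [map_add, map_mul, map_intCast, map_intCast] at h
  have hC : 1 + emb K ι ω = 2 * (a + b * emb K ι ω) := by
    have h : 1 + x = 2 * (a + b * x) := by linear_combination 2 * hK
    simpa only [emb, map_add, map_mul, map_one, map_intCast, map_ofNat] using congrArg ι h
  have him := congrArg im hC
  simp only [add_im, mul_im, add_re, mul_re, intCast_re, intCast_im, one_im, re_ofNat,
    im_ofNat] at him
  have hb : (2 * b : ℝ) = 1 := by
    apply mul_right_cancel₀ hs
    linear_combination -him
  have hb' : 2 * b = 1 := by exact_mod_cast hb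
  omega

theorem mobiusFin_subset_component {α β γ δ : 𝓞 K} (hdet : α * δ - β * γ = 1) {z : ℂ}
    (hz : z ∈ mobiusFin (emb K ι α) (emb K ι β) (emb K ι γ) (emb K ι δ))
    (hcomp : z ∈ connectedComponentIn (schmidtFin K ι) 0) :
    mobiusFin (emb K ι α) (emb K ι β) (emb K ι γ) (emb K ι δ) ⊆
      connectedComponentIn (schmidtFin K ι) 0 := by
  rw [connectedComponentIn_eq hcomp]
  exact (isPreconnected_mobiusFin (emb_det hdet)).subset_connectedComponentIn hz
    fun z' hz' => mem_schmidtFin_iff.mpr ⟨α, β, γ, δ, hdet, hz'⟩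

theorem div_mem_component_iff {α β γ δ : 𝓞 K} (hdet : α * δ - β * γ = 1) (hβ : β ≠ 0)
    (hδ : δ ≠ 0) :
    emb K ι α / emb K ι β ∈ connectedComponentIn (schmidtFin K ι) 0 ↔
      emb K ι γ / emb K ι δ ∈ connectedComponentIn (schmidtFin K ι) 0 := by
  have h₁ : emb K ι α / emb K ι β ∈
      mobiusFin (emb K ι α) (emb K ι β) (emb K ι γ) (emb K ι δ) :=
    Or.inr ⟨emb_ne_zero hβ, rfl⟩
  have h₂ : emb K ι γ / emb K ι δ ∈
      mobiusFin (emb K ι α) (emb K ι β) (emb K ι γ) (emb K ι δ) :=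
    Or.inl ⟨0, by simpa using emb_ne_zero hδ, by simp⟩
  exact ⟨fun h => mobiusFin_subset_component hdet h₁ h h₂,
    fun h => mobiusFin_subset_component hdet h₂ h h₁⟩

theorem emb_one : emb K ι 1 = 1 := by simp [emb]

theorem emb_add_one_mem_component_iff (κ : 𝓞 K) :
    emb K ι (κ + 1) ∈ connectedComponentIn (schmidtFin K ι) 0 ↔
      emb K ι κ ∈ connectedComponentIn (schmidtFin K ι) 0 := by
  simpa [emb_one] using div_mem_component_iff (ι := ι) (α := κ + 1) (β := 1) (γ := κ) (δ := 1)
    (by ring) one_ne_zero one_ne_zero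

/-- Parallel lines at `κ` and `κ + ω` are linked by a chain of pairwise intersecting circles. -/
theorem emb_add_generator_mem_component_iff {ω : 𝓞 K} {e N : ℤ} (hω : ω * ω = e * ω - N)
    (hN₁ : 1 ≤ N) (hN₃ : N ≤ 3) (κ : 𝓞 K) :
    emb K ι (κ + ω) ∈ connectedComponentIn (schmidtFin K ι) 0 ↔
      emb K ι κ ∈ connectedComponentIn (schmidtFin K ι) 0 := by
  obtain ⟨ω', hω'⟩ : ∃ ω' : 𝓞 K, ω * ω' = N := ⟨e - ω, by linear_combination -hω⟩
  have hω'₀ : ω' ≠ 0 := by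
    rintro rfl
    have : N = 0 := by exact_mod_cast (by simpa using hω'.symm : (N : 𝓞 K) = 0)
    omega
  have hstart := div_mem_component_iff (ι := ι) (α := 1 + κ * ω') (β := ω') (γ := κ) (δ := 1)
    (by ring) hω'₀ one_ne_zero
  rw [emb_one, div_one] at hstart
  rw [← hstart]
  obtain rfl | rfl | rfl : N = 1 ∨ N = 2 ∨ N = 3 := by omega
  · have hdiv : emb K ι (1 + κ * ω') / emb K ι ω' = emb K ι (κ + ω) := by
      rw [div_eq_iff (emb_ne_zero hω'₀)]
      have h : 1 + κ * ω' = (κ + ω) * ω' := by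
        push_cast at hω'
        linear_combination -hω'
      rw [h]
      simp [emb]
    rw [hdiv]
  · push_cast at hω'
    simpa [emb_one] using div_mem_component_iff (ι := ι) (α := κ + ω) (β := 1)
      (γ := 1 + κ * ω') (δ := ω') (by linear_combination hω') one_ne_zero hω'₀
  · push_cast at hω'
    have h₁ := div_mem_component_iff (ι := ι) (α := κ + ω) (β := 1)
      (γ := 2 + κ * ω') (δ := ω') (by linear_combination hω') one_ne_zero hω'₀
    have h₂ := div_mem_component_iff (ι := ι) (α := 2 + κ * ω') (β := ω')
      (γ := ω + 2 * κ) (δ := 2) (by linear_combination -hω') hω'₀ two_ne_zero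
    have h₃ := div_mem_component_iff (ι := ι) (α := ω + 2 * κ) (β := 2)
      (γ := 1 + κ * ω') (δ := ω') (by linear_combination hω') two_ne_zero hω'₀
    rw [emb_one, div_one] at h₁
    exact h₁.trans (h₂.trans h₃)

theorem emb_mem_component {ω : 𝓞 K} {e N : ℤ} (hω : ω * ω = e * ω - N)
    (hgen : ∀ x : 𝓞 K, ∃ a b : ℤ, x = a + b * ω) (hN₁ : 1 ≤ N) (hN₃ : N ≤ 3) (x : 𝓞 K) :
    emb K ι x ∈ connectedComponentIn (schmidtFin K ι) 0 := by
  have hmult (κ : 𝓞 K) (hκ : ∀ y, emb K ι (y + κ) ∈ connectedComponentIn (schmidtFin K ι) 0 ↔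
      emb K ι y ∈ connectedComponentIn (schmidtFin K ι) 0) (y : 𝓞 K)
      (hy : emb K ι y ∈ connectedComponentIn (schmidtFin K ι) 0) (n : ℤ) :
      emb K ι (y + n * κ) ∈ connectedComponentIn (schmidtFin K ι) 0 := by
    induction n with
    | zero => simpa using hy
    | succ n ih =>
      rw [← hκ] at ih
      convert ih using 2
      push_cast
      ring
    | pred n ih =>
      rw [← hκ]
      convert ih using 2
      push_cast
      ring
  obtain ⟨a, b, rfl⟩ := hgen x
  apply hmult ω (emb_add_generator_mem_component_iff hω hN₁ hN₃)
  have h₀ : emb K ι 0 ∈ connectedComponentIn (schmidtFin K ι) 0 := by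
    have : emb K ι 0 = 0 := by simp [emb]
    rw [this]
    exact mem_connectedComponentIn zero_mem_schmidtFin
  simpa using hmult 1 emb_add_one_mem_component_iff 0 h₀ a

theorem exists_normSq_sub_mul_lt {ω : 𝓞 K} (hs : (emb K ι ω).im ≠ 0)
    (hs' : (emb K ι ω).im ^ 2 < 3) (x : 𝓞 K) {y : 𝓞 K} (hy : y ≠ 0) :
    ∃ τ : 𝓞 K, normSq (emb K ι (x - τ * y)) < normSq (emb K ι y) := by
  obtain ⟨τ, hτ⟩ := exists_normSq_sub_emb_le hs (emb K ι x / emb K ι y)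
  have hy' := emb_ne_zero (ι := ι) hy
  refine ⟨τ, ?_⟩
  have h : emb K ι (x - τ * y) = (emb K ι x / emb K ι y - emb K ι τ) * emb K ι y := by
    rw [sub_mul, div_mul_cancel₀ _ hy']
    simp [emb]
  rw [h, normSq_mul]
  nlinarith [normSq_pos.mpr hy']

theorem exists_natCast_eq_normSq_emb {ω : 𝓞 K} {e N : ℤ} (he : e = 0 ∨ e = 1)
    (hω : ω * ω = e * ω - N) (hpos : 0 < 4 * N - e)
    (hgen : ∀ x : 𝓞 K, ∃ a b : ℤ, x = a + b * ω) (x : 𝓞 K) :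
    ∃ n : ℕ, normSq (emb K ι x) = n := by
  obtain ⟨hre, him⟩ := generator_re_im he (emb_generator (ι := ι) hω) hpos
  obtain ⟨a, b, rfl⟩ := hgen x
  have he' : (e : ℝ) ^ 2 = e := by rcases he with rfl | rfl <;> simp
  have h : normSq (emb K ι (a + b * ω)) = ((a ^ 2 + e * a * b + N * b ^ 2 : ℤ) : ℝ) := by
    rw [emb_add_mul, normSq_apply]
    simp only [add_re, add_im, mul_re, mul_im, intCast_re, intCast_im, hre]
    push_cast
    linear_combination (b : ℝ) ^ 2 / 4 * (him + he')
  refine ⟨(a ^ 2 + e * a * b + N * b ^ 2).toNat, ?_⟩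
  have hnonneg : 0 ≤ a ^ 2 + e * a * b + N * b ^ 2 := by
    exact_mod_cast h ▸ normSq_nonneg (emb K ι (a + b * ω))
  rw [h]
  exact_mod_cast (Int.toNat_of_nonneg hnonneg).symm

theorem isConnected_schmidtFin {ω : 𝓞 K} {e N : ℤ} (he : e = 0 ∨ e = 1)
    (hω : ω * ω = e * ω - N) (hpos : 0 < 4 * N - e)
    (hgen : ∀ x : 𝓞 K, ∃ a b : ℤ, x = a + b * ω) (hN₃ : N ≤ 3) (hlt : 4 * N - e < 12) :
    IsConnected (schmidtFin K ι) := by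
  obtain ⟨-, him⟩ := generator_re_im he (emb_generator (ι := ι) hω) hpos
  have hpos' : (0 : ℝ) < 4 * N - e := by exact_mod_cast hpos
  have hlt' : (4 * N - e : ℝ) < 12 := by exact_mod_cast hlt
  have hs : (emb K ι ω).im ≠ 0 := by
    intro h
    rw [h] at him
    linarith
  have hpoint : ∀ n : ℕ, ∀ α β γ δ : 𝓞 K, α * δ - β * γ = 1 → β ≠ 0 →
      normSq (emb K ι β) = n →
      emb K ι α / emb K ι β ∈ connectedComponentIn (schmidtFin K ι) 0 := by
    intro n
    induction n using Nat.strong_induction_on with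
    | _ n ih =>
      intro α β γ δ hdet hβ hn
      obtain ⟨τ, hτ⟩ := exists_normSq_sub_mul_lt hs (by linarith) δ hβ
      have hdet' : α * (δ - τ * β) - β * (γ - τ * α) = 1 := by linear_combination hdet
      by_cases hδ : δ - τ * β = 0
      · have hα : emb K ι α / emb K ι β = emb K ι (-(α * (γ - τ * α))) := by
          rw [div_eq_iff (emb_ne_zero hβ)]
          have h : α = -(α * (γ - τ * α)) * β := by
            linear_combination α * (α * hδ) - α * hdet'
          conv_lhs => rw [h]
          simp [emb]
        rw [hα]
        exact emb_mem_component hω hgen (by omega) hN₃ _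
      · rw [div_mem_component_iff hdet' hβ hδ]
        obtain ⟨m, hm⟩ := exists_natCast_eq_normSq_emb (ι := ι) he hω hpos hgen (δ - τ * β)
        rw [hm, hn, Nat.cast_lt] at hτ
        exact ih m hτ _ _ (-α) (-β) (by linear_combination hdet') hδ hm
  have hpoint' (α β γ δ : 𝓞 K) (hdet : α * δ - β * γ = 1) (hβ : β ≠ 0) :
      emb K ι α / emb K ι β ∈ connectedComponentIn (schmidtFin K ι) 0 := by
    obtain ⟨n, hn⟩ := exists_natCast_eq_normSq_emb (ι := ι) he hω hpos hgen β
    exact hpoint n α β γ δ hdet hβ hn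
  have heq : schmidtFin K ι = connectedComponentIn (schmidtFin K ι) 0 := by
    refine Set.Subset.antisymm (fun z hz => ?_) (connectedComponentIn_subset _ _)
    obtain ⟨α, β, γ, δ, hdet, hz⟩ := mem_schmidtFin_iff.mp hz
    by_cases hβ : β = 0
    · have hδ : δ ≠ 0 := by
        rintro rfl
        simp [hβ] at hdet
      exact mobiusFin_subset_component hdet
        (Or.inl ⟨0, by simpa using emb_ne_zero hδ, by simp⟩)
        (hpoint' γ δ (-α) (-β) (by linear_combination hdet) hδ) hz
    · exact mobiusFin_subset_component hdet (Or.inr ⟨emb_ne_zero hβ, rfl⟩)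
        (hpoint' α β γ δ hdet hβ) hz
  rw [heq]
  exact isConnected_connectedComponentIn_iff.mpr zero_mem_schmidtFin

end Schmidt

/-- The finite part `S_K°` of the Schmidt arrangement of an imaginary
quadratic field `K` is a connected subset of `ℂ` if and only if
`Δ ∈ {−3, −4, −7, −8, −11}`, i.e. iff `O_K` is a Euclidean domain. -/
theorem stmt16 (K : Type) [Field K] [NumberField K]
    (hdeg : Module.finrank ℚ K = 2) (hdisc : NumberField.discr K < 0)
    (ι : K →+* ℂ) :
    IsConnected (schmidtFin K ι) ↔
      NumberField.discr K ∈ ({-3, -4, -7, -8, -11} : Set ℤ) := by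
  obtain ⟨ω, e, N, he, hω, hdiscr, hgen⟩ := exists_integral_generator hdeg
  have hpos : 0 < 4 * N - e := by omega
  rw [hdiscr]
  constructor
  · intro hconn
    have hN : N < 4 := by
      by_contra! hN
      exact not_isPreconnected_schmidtFin he hω hgen hN hconn.isPreconnected
    have hexcl : ¬ (e = 0 ∧ N = 3) := by
      rintro ⟨rfl, rfl⟩
      obtain ⟨-, him⟩ := generator_re_im he (emb_generator (ι := ι) hω) hpos
      refine false_of_generator_sq_eq_neg_three (ι := ι) (by simpa using hω) (fun h => ?_) hgen
      norm_num [h] at him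
    simp only [Set.mem_insert_iff, Set.mem_singleton_iff]
    omega
  · intro hmem
    simp only [Set.mem_insert_iff, Set.mem_singleton_iff] at hmem
    exact isConnected_schmidtFin he hω hpos hgen (by omega) (by omega)
end

section
/- Suppose Δ < −11, and let S_K° := ⋃_{M ∈ SL₂(O_K)} (M(ℝ̂) ∩ ℂ) ⊆ ℂ be the (finite part of the) Schmidt arrangement of K. Then the topological space S_K° (with the subspace topology from ℂ) has infinitely many connected components. -/
open Complex ComplexConjugate NumberField

/-- A set of complex numbers which is stable under translation by natural numbers, misses some
circle and meets the open disk bounded by it has infinitely many connected components. -/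
lemma infinite_connectedComponents_of_disk {S : Set ℂ}
    (hS : ∀ z ∈ S, ∀ n : ℕ, z + n ∈ S) {g p : ℂ} {r : ℝ}
    (hr : ∀ z ∈ S, ∀ n : ℕ, dist z (g + n) ≠ r) (hp : p ∈ S) (hpg : dist p g < r) :
    Infinite (ConnectedComponents S) := by
  obtain ⟨k, hk⟩ := exists_nat_gt (2 * r)
  let q : ℕ → S := fun n => ⟨p + (k * n : ℕ), hS p hp _⟩
  let U : ℕ → Set S := fun n => {z | dist (z : ℂ) (g + (k * n : ℕ)) < r}
  have hU : ∀ n, IsClopen (U n) := by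
    intro n
    refine ⟨?_, isOpen_lt (by fun_prop) (by fun_prop)⟩
    have : U n = {z : S | dist (z : ℂ) (g + (k * n : ℕ)) ≤ r} := by
      ext z
      exact ⟨fun h => (show _ < r from h).le, fun h => lt_of_le_of_ne h (hr z z.2 _)⟩
    rw [this]
    exact isClosed_le (by fun_prop) (by fun_prop)
  have hq : ∀ n, q n ∈ U n := by
    intro n
    simpa [q, U] using hpg
  refine Infinite.of_injective (fun n => (q n : ConnectedComponents S)) ?_
  intro m n hmn
  by_contra hne
  have hmem : q m ∈ U n := by
    apply (hU n).connectedComponent_subset (hq n)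
    rw [← ConnectedComponents.coe_eq_coe.1 hmn]
    exact mem_connectedComponent
  have h1 : dist (p + (k * m : ℕ)) (g + (k * n : ℕ)) < r := hmem
  rw [dist_eq_norm] at h1 hpg
  have h2 : ((k * m : ℕ) : ℂ) - (k * n : ℕ)
      = (p + (k * m : ℕ) - (g + (k * n : ℕ))) - (p - g) := by ring
  have h3 : ‖((k * m : ℕ) : ℂ) - (k * n : ℕ)‖ < 2 * r := by
    rw [h2]
    exact (norm_sub_le _ _).trans_lt (by linarith)
  have h4 : ((k * m : ℕ) : ℂ) - (k * n : ℕ) = ((k * ((m : ℤ) - n) : ℤ) : ℂ) := by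
    push_cast; ring
  rw [h4, Complex.norm_intCast, Int.cast_mul, abs_mul] at h3
  have h5 : (1 : ℝ) ≤ |(((m : ℤ) - n : ℤ) : ℝ)| := by
    rw [← Int.cast_abs]
    exact_mod_cast Int.one_le_abs (sub_ne_zero.2 (Nat.cast_injective.ne hne))
  simp only [Int.cast_natCast, Nat.abs_cast] at h3
  nlinarith [(Nat.cast_nonneg k : (0 : ℝ) ≤ k)]

/-- The equation of a Möbius image of the extended real line. -/
lemma im_eq_zero_of_mem_mobiusFin {α β γ δ z : ℂ} (hdet : α * δ - β * γ = 1)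
    (hz : z ∈ mobiusFin α β γ δ) : ((δ * z - γ) * conj (α - β * z)).im = 0 := by
  rcases hz with ⟨x, hx, rfl⟩ | ⟨hβ, rfl⟩
  · have h1 : δ * ((α * x + γ) / (β * x + δ)) - γ = x * (1 / (β * x + δ)) := by
      rw [mul_one_div, eq_div_iff hx, sub_mul, mul_assoc, div_mul_cancel₀ _ hx]
      linear_combination (x : ℂ) * hdet
    have h2 : α - β * ((α * x + γ) / (β * x + δ)) = 1 / (β * x + δ) := by
      field_simp
      linear_combination hdet
    rw [h1, h2, mul_assoc, Complex.mul_conj, ← Complex.ofReal_mul, Complex.ofReal_im]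
  · rw [mul_div_cancel₀ _ hβ]
    simp

/-- If the circle `b (x² + y²) - (u y + v x) + b' = 0` of discriminant one meets the circle with
centre `(c, t)` orthogonal to the unit circle, then their inner product is bounded in terms of the
radius of the latter. -/
lemma sq_inner_le_of_circles_meet_s17 {b b' u v c t x y R : ℝ}
    (hdisc : u ^ 2 + v ^ 2 - 4 * b * b' = 1)
    (heq : b * (x ^ 2 + y ^ 2) - (u * y + v * x) + b' = 0)
    (hR : c ^ 2 + t ^ 2 - 1 = R) (hxy : (x - c) ^ 2 + (y - t) ^ 2 = R) :
    (u * t + v * c - b - b') ^ 2 ≤ R := by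
  have hlin : b + b' - (u * t + v * c) + 2 * b * R
      = -((2 * b * c - v) * (x - c) + (2 * b * t - u) * (y - t)) := by
    subst hR
    linear_combination heq - b * hxy
  have hcs : ((2 * b * c - v) * (x - c) + (2 * b * t - u) * (y - t)) ^ 2
      ≤ ((2 * b * c - v) ^ 2 + (2 * b * t - u) ^ 2) * R := by
    rw [← hxy]
    nlinarith [sq_nonneg ((2 * b * c - v) * (y - t) - (2 * b * t - u) * (x - c))]
  have hnorm : (2 * b * c - v) ^ 2 + (2 * b * t - u) ^ 2
      = 1 + 4 * b ^ 2 * R + 4 * b * (b + b' - (u * t + v * c)) := by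
    subst hR
    linear_combination hdisc
  rw [hnorm, ← neg_sq, ← hlin] at hcs
  linarith

lemma sq_le_sq_add_half_mul_int {s t : ℝ} (hs : 0 < s) (ht0 : 0 < t) (hts : t ≤ s / 4) (j : ℤ) :
    t ^ 2 ≤ (t + s / 2 * j) ^ 2 := by
  rw [sq_le_sq, abs_of_pos ht0, le_abs]
  rcases le_or_gt 0 j with h | h
  · have : (0 : ℝ) ≤ j := by exact_mod_cast h
    left
    nlinarith
  · have : (j : ℝ) ≤ -1 := by exact_mod_cast Int.le_sub_one_of_lt h
    right
    nlinarith

/-- The ghost circle: it is disjoint from every circle `M(ℝ̂)` with `M` of determinant one over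
`ℤ + ℤ w`, where `w = (T + i s) / 2` and `s² = 4 N - T`. -/
lemma dist_ne_of_mem_mobiusFin {T N : ℤ} (hT : T = 0 ∨ T = 1) {s t r : ℝ} (hs : 0 < s)
    (hsq : s ^ 2 = 4 * N - T) (ht : t = (s ^ 2 - T) / (4 * s)) (ht0 : 0 < t)
    (hr : r ^ 2 = t ^ 2 - 3 / 4) {a₁ a₂ b₁ b₂ c₁ c₂ d₁ d₂ : ℤ} {w α β γ δ z : ℂ}
    (hw : w = ⟨T / 2, s / 2⟩) (hα : α = a₁ + a₂ * w) (hβ : β = b₁ + b₂ * w)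
    (hγ : γ = c₁ + c₂ * w) (hδ : δ = d₁ + d₂ * w) (hdet : α * δ - β * γ = 1)
    (hz : z ∈ mobiusFin α β γ δ) : dist z ⟨1 / 2, t⟩ ≠ r := by
  intro hdist
  have heq := im_eq_zero_of_mem_mobiusFin hdet hz
  have hαr : α.re = a₁ + a₂ * (T / 2) := by simp [hα, hw]
  have hαi : α.im = a₂ * (s / 2) := by simp [hα, hw]
  have hβr : β.re = b₁ + b₂ * (T / 2) := by simp [hβ, hw]
  have hβi : β.im = b₂ * (s / 2) := by simp [hβ, hw]
  have hγr : γ.re = c₁ + c₂ * (T / 2) := by simp [hγ, hw]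
  have hγi : γ.im = c₂ * (s / 2) := by simp [hγ, hw]
  have hδr : δ.re = d₁ + d₂ * (T / 2) := by simp [hδ, hw]
  have hδi : δ.im = d₂ * (s / 2) := by simp [hδ, hw]
  have hre := congrArg Complex.re hdet
  have him := congrArg Complex.im hdet
  simp only [Complex.sub_re, Complex.mul_re, Complex.one_re, Complex.sub_im, Complex.mul_im,
    Complex.one_im] at hre him
  have hxy : (z.re - 1 / 2) ^ 2 + (z.im - t) ^ 2 = t ^ 2 - 3 / 4 := by
    rw [← hr, ← hdist, Complex.dist_eq, ← Complex.normSq_eq_norm_sq, Complex.normSq_apply]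
    simp only [Complex.sub_re, Complex.sub_im]
    ring
  simp only [Complex.sub_re, Complex.mul_re, Complex.sub_im, Complex.mul_im, Complex.conj_re,
    Complex.conj_im] at heq
  have hle := sq_inner_le_of_circles_meet_s17
    (b := β.re * δ.im - β.im * δ.re) (b' := α.re * γ.im - α.im * γ.re)
    (u := α.re * δ.re + α.im * δ.im - γ.re * β.re - γ.im * β.im)
    (v := α.re * δ.im - α.im * δ.re - γ.re * β.im + γ.im * β.re)
    (c := 1 / 2) (t := t) (x := z.re) (y := z.im) (R := t ^ 2 - 3 / 4)
    (by
      have e : (α.re * δ.re - α.im * δ.im - (β.re * γ.re - β.im * γ.im)) ^ 2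
          + (α.re * δ.im + α.im * δ.re - (β.re * γ.im + β.im * γ.re)) ^ 2 = 1 := by
        rw [hre, him]; norm_num
      linear_combination e)
    (by linear_combination -heq) (by ring) hxy
  set j : ℤ := N * (a₂ * d₂ - c₂ * b₂) + (a₁ * d₂ - c₁ * b₂) - (b₁ * d₂ - b₂ * d₁)
    - (a₁ * c₂ - a₂ * c₁) with hj
  have h4t : 4 * s * t = s ^ 2 - T := by rw [ht]; field_simp
  have hE : (α.re * δ.re + α.im * δ.im - γ.re * β.re - γ.im * β.im) * t
      + (α.re * δ.im - α.im * δ.re - γ.re * β.im + γ.im * β.re) * (1 / 2)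
      - (β.re * δ.im - β.im * δ.re) - (α.re * γ.im - α.im * γ.re) = t + s / 2 * j := by
    have hu : α.re * δ.re + α.im * δ.im - γ.re * β.re - γ.im * β.im
        = 1 + s ^ 2 / 2 * (a₂ * d₂ - c₂ * b₂) := by
      rw [← hre, hαi, hδi, hγi, hβi]; ring
    have hv : α.re * δ.im - α.im * δ.re - γ.re * β.im + γ.im * β.re
        = s * ((a₁ * d₂ - c₁ * b₂) + T / 2 * (a₂ * d₂ - c₂ * b₂)) := by
      have : α.re * δ.im - α.im * δ.re - γ.re * β.im + γ.im * β.re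
          = 2 * (α.re * δ.im - γ.re * β.im) := by linear_combination -him
      rw [this, hαr, hδi, hγr, hβi]; ring
    rw [hu, hv, hαr, hαi, hβr, hβi, hγr, hγi, hδr, hδi, hj]
    push_cast
    linear_combination (s / 8 * (a₂ * d₂ - c₂ * b₂)) * h4t
      + (s / 8 * (a₂ * d₂ - c₂ * b₂)) * hsq
  rw [hE] at hle
  have hT0 : (0 : ℝ) ≤ T := by rcases hT with rfl | rfl <;> norm_num
  have hts : t ≤ s / 4 := by
    rw [ht, div_le_div_iff₀ (by positivity) (by norm_num)]
    linarith
  have := sq_le_sq_add_half_mul_int hs ht0 hts j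
  linarith

section

variable (K : Type) [Field K] [NumberField K]

/-- The ring of integers of a quadratic field has an integral basis containing `1`. -/
lemma exists_span_one_eq_top (hdeg : Module.finrank ℚ K = 2) :
    ∃ w : 𝓞 K, ∀ x : 𝓞 K, ∃ p q : ℤ, x = p + q * w := by
  have hrank : Module.finrank ℤ (𝓞 K) = 2 := by rw [RingOfIntegers.rank, hdeg]
  let e : Module.Basis (Fin 2) ℤ (𝓞 K) := Module.finBasisOfFinrankEq ℤ (𝓞 K) hrank
  have he : ∀ x, x = (e.repr x 0 : 𝓞 K) * e 0 + (e.repr x 1 : 𝓞 K) * e 1 := by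
    intro x
    conv_lhs => rw [← e.sum_repr x]
    simp [Fin.sum_univ_two]
  set a := e.repr 1 0
  set c := e.repr 1 1
  have h1 : (1 : 𝓞 K) = a * e 0 + c * e 1 := he 1
  have hcop : IsCoprime a c := by
    rw [Int.isCoprime_iff_gcd_eq_one]
    obtain ⟨a', ha'⟩ := Int.gcd_dvd_left (a := a) (b := c)
    obtain ⟨c', hc'⟩ := Int.gcd_dvd_right (a := a) (b := c)
    have ha : (a : 𝓞 K) = (Int.gcd a c : ℤ) * a' := by exact_mod_cast congrArg Int.cast ha'
    have hc : (c : 𝓞 K) = (Int.gcd a c : ℤ) * c' := by exact_mod_cast congrArg Int.cast hc'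
    have hmul : algebraMap ℤ (𝓞 K) (Int.gcd a c : ℤ) * (a' * e 0 + c' * e 1) = 1 := by
      rw [eq_intCast]
      linear_combination -h1 - e 0 * ha - e 1 * hc
    have hnorm := congrArg (Algebra.norm ℤ) hmul
    rw [map_mul, Algebra.norm_algebraMap, (Algebra.norm ℤ).map_one, hrank] at hnorm
    have hunit : IsUnit (Int.gcd a c : ℤ) :=
      (isUnit_pow_iff two_ne_zero).1 (IsUnit.of_mul_eq_one _ hnorm)
    simpa [Int.isUnit_iff_natAbs_eq] using hunit
  obtain ⟨u, v, huv⟩ := hcop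
  have huv' : (u : 𝓞 K) * a + v * c = 1 := by exact_mod_cast congrArg (Int.cast (R := 𝓞 K)) huv
  refine ⟨-v * e 0 + u * e 1, fun x => ?_⟩
  refine ⟨e.repr x 0 * u + e.repr x 1 * v, e.repr x 1 * a - e.repr x 0 * c, ?_⟩
  push_cast
  conv_lhs => rw [he x]
  linear_combination (-(e.repr x 0 : 𝓞 K) * e 0 - e.repr x 1 * e 1) * huv'
    - (e.repr x 0 * u + e.repr x 1 * v) * h1

variable {K}

/-- The discriminant of a quadratic field with integral basis `1, w`, where `w² = p + q w`. -/
lemma discr_eq_of_span (hdeg : Module.finrank ℚ K = 2) {w : 𝓞 K}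
    (hw : ∀ x : 𝓞 K, ∃ p q : ℤ, x = p + q * w) {p q : ℤ} (hpq : w * w = p + q * w) :
    discr K = q ^ 2 + 4 * p := by
  have hrank : Module.finrank ℤ (𝓞 K) = 2 := by rw [RingOfIntegers.rank, hdeg]
  let b : Module.Basis (Fin 2) ℤ (𝓞 K) := basisOfTopLeSpanOfCardEqFinrank ![1, w]
    (by
      intro x _
      obtain ⟨p, q, rfl⟩ := hw x
      rw [Matrix.range_cons, Matrix.range_cons, Matrix.range_empty, Set.union_empty,
        Set.singleton_union, Submodule.mem_span_pair]
      exact ⟨p, q, by simp⟩)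
    (by simp [hrank])
  have hb0 : b 0 = 1 := by simp [b]
  have hb1 : b 1 = w := by simp [b]
  have hrepr : ∀ m n : ℤ, b.repr (m + n * w) = Finsupp.single 0 m + Finsupp.single 1 n := by
    intro m n
    rw [← b.repr.symm.injective.eq_iff]
    simp [hb0, hb1]
  have htr1 : Algebra.trace ℤ (𝓞 K) 1 = 2 := by
    have := Algebra.trace_algebraMap (S := 𝓞 K) (1 : ℤ)
    simpa [hrank] using this
  have htrw : Algebra.trace ℤ (𝓞 K) w = q := by
    rw [Algebra.trace_eq_matrix_trace b, Matrix.trace_fin_two, Algebra.leftMulMatrix_eq_repr_mul,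
      Algebra.leftMulMatrix_eq_repr_mul, hb0, hb1, hpq, hrepr]
    have := hrepr 0 1
    simp at this
    simp [this]
  have htr : ∀ m n : ℤ, Algebra.trace ℤ (𝓞 K) (m + n * w) = 2 * m + q * n := by
    intro m n
    have : (m + n * w : 𝓞 K) = m • 1 + n • w := by simp
    rw [this, map_add, map_smul, map_smul, htr1, htrw]
    simp [mul_comm]
  rw [← discr_eq_discr K b, Algebra.discr_def, Matrix.det_fin_two]
  simp only [Algebra.traceMatrix_apply, Algebra.traceForm_apply, hb0, hb1, mul_one, one_mul, hpq,
    htr1, htrw, htr]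
  ring

lemma emb_eq_comp (ι : K →+* ℂ) (x : 𝓞 K) : emb K ι x = ι.comp (algebraMap (𝓞 K) K) x := rfl

/-- The ring of integers of an imaginary quadratic field is `ℤ + ℤ w` with `w = (T + √Δ) / 2`,
where `T ∈ {0, 1}` has the parity of `Δ`. -/
lemma exists_generator (hdeg : Module.finrank ℚ K = 2) (hdisc : discr K < 0) (ι : K →+* ℂ) :
    ∃ (w : 𝓞 K) (T N : ℤ), (T = 0 ∨ T = 1) ∧ discr K = T - 4 * N ∧ w * w = T * w - N ∧
      emb K ι w = ⟨T / 2, √(4 * N - T) / 2⟩ ∧ ∀ x : 𝓞 K, ∃ p q : ℤ, x = p + q * w := by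
  obtain ⟨w, hw⟩ := exists_span_one_eq_top K hdeg
  obtain ⟨p, q, hpq⟩ := hw (w * w)
  have hd := discr_eq_of_span hdeg hw hpq
  obtain ⟨k, T, hT, rfl⟩ : ∃ k T : ℤ, (T = 0 ∨ T = 1) ∧ q = 2 * k + T :=
    ⟨q / 2, q % 2, by omega, by omega⟩
  have hTT : T ^ 2 = T := by rcases hT with rfl | rfl <;> norm_num
  have hdN : discr K = T - 4 * (-(p + k ^ 2 + k * T)) := by
    rw [hd]; linear_combination hTT
  generalize hN : -(p + k ^ 2 + k * T) = N at hdN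
  have hN' : -((p : 𝓞 K) + k ^ 2 + k * T) = N := by
    exact_mod_cast congrArg (Int.cast (R := 𝓞 K)) hN
  push_cast at hpq
  have hpos : (0 : ℝ) ≤ 4 * N - T := by exact_mod_cast (by omega : 0 ≤ 4 * N - T)
  have hroot : (2 * emb K ι w - (2 * k + T)) ^ 2 = ((√(4 * N - T) : ℝ) * I) ^ 2 := by
    have h1 : emb K ι w * emb K ι w = p + (2 * k + T) * emb K ι w := by
      simpa only [emb_eq_comp, map_mul, map_add, map_intCast, map_ofNat] using
        congrArg (emb K ι) hpq
    have hC : -((p : ℂ) + k ^ 2 + k * T) = N := by exact_mod_cast congrArg (Int.cast (R := ℂ)) hN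
    have hTC : (T : ℂ) ^ 2 = T := by exact_mod_cast congrArg (Int.cast (R := ℂ)) hTT
    rw [mul_pow, I_sq, ← Complex.ofReal_pow, Real.sq_sqrt hpos]
    push_cast
    linear_combination 4 * h1 - 4 * hC + hTC
  rcases sq_eq_sq_iff_eq_or_eq_neg.1 hroot with h | h
  · refine ⟨w - k, T, N, hT, hdN, ?_, ?_, fun x => ?_⟩
    · linear_combination hpq - hN'
    · have : emb K ι (w - k) = (T + (√(4 * N - T) : ℝ) * I) / 2 := by
        simp only [emb_eq_comp, map_sub, map_intCast] at h ⊢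
        linear_combination h / 2
      rw [this]
      apply Complex.ext <;> simp
    · obtain ⟨m, n, rfl⟩ := hw x
      exact ⟨m + n * k, n, by push_cast; ring⟩
  · refine ⟨-w + k + T, T, N, hT, hdN, ?_, ?_, fun x => ?_⟩
    · linear_combination hpq - hN'
    · have : emb K ι (-w + k + T) = (T + (√(4 * N - T) : ℝ) * I) / 2 := by
        simp only [emb_eq_comp, map_add, map_neg, map_intCast] at h ⊢
        linear_combination -h / 2
      rw [this]
      apply Complex.ext <;> simp
    · obtain ⟨m, n, rfl⟩ := hw x
      exact ⟨m + n * (k + T), -n, by push_cast; ring⟩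

/-- The order `ℤ[√-3]` is not a ring of integers. -/
lemma mul_self_ne_neg_three {w : 𝓞 K} {ι : K →+* ℂ} (him : (emb K ι w).im ≠ 0)
    (hw : ∀ x : 𝓞 K, ∃ p q : ℤ, x = p + q * w) : w * w ≠ -3 := by
  intro h3
  have h3' : (w : K) * w = -3 := by
    simpa only [map_mul, map_neg, map_ofNat] using congrArg (algebraMap (𝓞 K) K) h3
  have hint : IsIntegral ℤ ((1 + (w : K)) / 2) := by
    refine ⟨Polynomial.X ^ 2 - Polynomial.X + 1, by monicity!, ?_⟩
    simp only [Polynomial.eval₂_add, Polynomial.eval₂_sub, Polynomial.eval₂_pow,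
      Polynomial.eval₂_X, Polynomial.eval₂_one]
    linear_combination h3' / 4
  obtain ⟨p, q, hpq⟩ := hw ⟨_, hint⟩
  have h2 : (1 + (w : K)) / 2 = p + q * w := by
    have h := congrArg (algebraMap (𝓞 K) K) hpq
    simp only [map_add, map_mul, map_intCast] at h
    exact h
  have h4 : 1 + emb K ι w = 2 * (p + q * emb K ι w) := by
    have : 1 + (w : K) = 2 * (p + q * w) := by rw [← h2]; ring
    simpa only [emb, map_add, map_mul, map_intCast, map_one, map_ofNat] using congrArg ι this
  have h5 : (emb K ι w).im * 1 = (emb K ι w).im * (2 * q) := by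
    have := congrArg Complex.im h4
    simp at this
    linear_combination this
  have h6 : (1 : ℤ) = 2 * q := by exact_mod_cast mul_left_cancel₀ him h5
  omega

lemma mobiusFin_subset_schmidtFin (ι : K →+* ℂ) {α β γ δ : 𝓞 K} (h : α * δ - γ * β = 1) :
    mobiusFin (emb K ι α) (emb K ι β) (emb K ι γ) (emb K ι δ) ⊆ schmidtFin K ι :=
  Set.subset_iUnion_of_subset ⟨!![α, γ; β, δ], by rw [Matrix.det_fin_two_of, h]⟩ (by simp)

lemma div_mem_schmidtFin (ι : K →+* ℂ) {α β γ δ : 𝓞 K} (h : α * δ - γ * β = 1)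
    (hβ : emb K ι β ≠ 0) : emb K ι α / emb K ι β ∈ schmidtFin K ι :=
  mobiusFin_subset_schmidtFin ι h (Or.inr ⟨hβ, rfl⟩)

lemma add_intCast_mem_schmidtFin {ι : K →+* ℂ} {z : ℂ} (hz : z ∈ schmidtFin K ι) (n : ℤ) :
    z + n ∈ schmidtFin K ι := by
  obtain ⟨M, hM⟩ := Set.mem_iUnion.1 hz
  have hdet : (M.1 0 0 + n * M.1 1 0) * M.1 1 1 - (M.1 0 1 + n * M.1 1 1) * M.1 1 0 = 1 := by
    have := M.2
    rw [Matrix.det_fin_two] at this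
    linear_combination this
  apply mobiusFin_subset_schmidtFin ι hdet
  have hadd : ∀ x y : 𝓞 K, emb K ι (x + n * y) = emb K ι x + n * emb K ι y := by
    simp [emb_eq_comp]
  rw [hadd, hadd]
  rcases hM with ⟨x, hx, rfl⟩ | ⟨hβ, rfl⟩
  · refine Or.inl ⟨x, hx, ?_⟩
    rw [eq_div_iff hx, add_mul, div_mul_cancel₀ _ hx]
    ring
  · exact Or.inr ⟨hβ, by field_simp⟩

/-- For `Δ < -11` there is a circle which is disjoint from the Schmidt arrangement but encloses
one of its points. -/
lemma exists_ghost_circle (hdeg : Module.finrank ℚ K = 2) (hdisc : discr K < -11) (ι : K →+* ℂ) :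
    ∃ (g p : ℂ) (r : ℝ), (∀ z ∈ schmidtFin K ι, dist z g ≠ r) ∧ p ∈ schmidtFin K ι ∧
      dist p g < r := by
  obtain ⟨w, T, N, hT, hd, hww, hw, hspan⟩ := exists_generator hdeg (by omega) ι
  have hpos : (0 : ℝ) < 4 * N - T := by exact_mod_cast (by omega : 0 < 4 * N - T)
  have hs := Real.sqrt_pos.2 hpos
  have hsq := Real.sq_sqrt hpos.le
  generalize √(4 * N - T : ℝ) = s at hw hs hsq
  have hN : 4 ≤ N := by
    rcases hT with rfl | rfl
    · by_contra hlt
      obtain rfl : N = 3 := by omega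
      refine mul_self_ne_neg_three (ι := ι) ?_ hspan (by simpa using hww)
      simp [hw, hs.ne']
    · omega
  have hN' : (4 : ℝ) ≤ N := by exact_mod_cast hN
  have hT1 : (T : ℝ) ≤ 1 := by rcases hT with rfl | rfl <;> norm_num
  have hst : 0 < s ^ 2 - T := by linarith
  let t := (s ^ 2 - T) / (4 * s)
  have ht0 : 0 < t := by positivity
  have hrad : 1 / (16 * s ^ 2) < t ^ 2 - 3 / 4 := by
    have : t ^ 2 - 3 / 4 = ((s ^ 2 - T) ^ 2 - 12 * s ^ 2) / (16 * s ^ 2) := by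
      simp only [t]
      field_simp
      ring
    rw [this]
    gcongr
    rcases hT with rfl | rfl <;> push_cast at * <;> nlinarith
  have hR : 0 < t ^ 2 - 3 / 4 := lt_trans (by positivity) hrad
  suffices h : ∃ p ∈ schmidtFin K ι, (p.re - 1 / 2) ^ 2 + (p.im - t) ^ 2 < t ^ 2 - 3 / 4 by
    obtain ⟨p, hp, hlt⟩ := h
    refine ⟨⟨1 / 2, t⟩, p, √(t ^ 2 - 3 / 4), fun z hz => ?_, hp, ?_⟩
    · obtain ⟨M, hM⟩ := Set.mem_iUnion.1 hz
      have hcoord : ∀ x : 𝓞 K, ∃ m n : ℤ, emb K ι x = m + n * emb K ι w := by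
        intro x
        obtain ⟨m, n, rfl⟩ := hspan x
        exact ⟨m, n, by simp [emb_eq_comp]⟩
      obtain ⟨_, _, hα⟩ := hcoord (M.1 0 0)
      obtain ⟨_, _, hβ⟩ := hcoord (M.1 1 0)
      obtain ⟨_, _, hγ⟩ := hcoord (M.1 0 1)
      obtain ⟨_, _, hδ⟩ := hcoord (M.1 1 1)
      refine dist_ne_of_mem_mobiusFin hT hs hsq rfl ht0 (Real.sq_sqrt hR.le) hw hα hβ hγ hδ ?_ hM
      have hdet := M.2
      rw [Matrix.det_fin_two] at hdet
      have := congrArg (emb K ι) hdet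
      simp only [emb_eq_comp, map_sub, map_mul, map_one] at this ⊢
      linear_combination this
    · rw [Complex.dist_eq, Real.lt_sqrt (norm_nonneg _), ← Complex.normSq_eq_norm_sq,
        Complex.normSq_apply]
      simp only [Complex.sub_re, Complex.sub_im]
      linarith
  rcases hT with rfl | rfl
  · simp only [Int.cast_zero, zero_mul, zero_sub, sub_zero, zero_div] at hww hw hsq
    have ht : t = s / 4 := by
      simp only [t]
      push_cast
      field_simp
      ring
    have htwo : emb K ι 2 = 2 := by simp only [emb_eq_comp, map_ofNat]
    rcases Int.even_or_odd' N with ⟨n, rfl | rfl⟩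
    · refine ⟨_, div_mem_schmidtFin ι (α := 1 + w) (β := 2) (γ := n) (δ := 1 - w) ?_ ?_, ?_⟩
      · push_cast at hww
        linear_combination -hww
      · simp [htwo]
      · have : emb K ι (1 + w) / emb K ι 2 = ⟨1 / 2, s / 4⟩ := by
          have h1 : emb K ι (1 + w) = 1 + emb K ι w := by simp only [emb_eq_comp, map_add, map_one]
          rw [htwo, h1, hw]
          apply Complex.ext <;> simp
          ring
        rw [this, ht]
        rw [ht] at hR
        simpa using hR
    · refine ⟨_, div_mem_schmidtFin ι (α := w) (β := 2) (γ := n) (δ := -w) ?_ ?_, ?_⟩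
      · push_cast at hww
        linear_combination -hww
      · simp [htwo]
      · have : emb K ι w / emb K ι 2 = ⟨0, s / 4⟩ := by
          rw [htwo, hw]
          apply Complex.ext <;> simp
          ring
        rw [this, ht]
        have : (5 : ℝ) ≤ (2 * n + 1 : ℤ) := by exact_mod_cast (by omega : 5 ≤ 2 * n + 1)
        norm_num
        nlinarith
  · simp only [Int.cast_one, one_mul] at hww hw hsq
    have ht : s / 4 - t = 1 / (4 * s) := by
      simp only [t]
      push_cast
      field_simp
      ring
    have hfour : emb K ι 4 = 4 := by simp only [emb_eq_comp, map_ofNat]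
    refine ⟨_, div_mem_schmidtFin ι (α := 1 + 2 * w) (β := 4) (γ := -N - 1) (δ := 2 * w - 3)
      ?_ ?_, ?_⟩
    · linear_combination 4 * hww
    · simp [hfour]
    · have : emb K ι (1 + 2 * w) / emb K ι 4 = ⟨1 / 2, s / 4⟩ := by
        have h1 : emb K ι (1 + 2 * w) = 1 + 2 * emb K ι w := by
          simp only [emb_eq_comp, map_add, map_one, map_mul, map_ofNat]
        rw [hfour, h1, hw]
        apply Complex.ext <;> simp <;> ring
      rw [this]
      simp only [ht]
      convert hrad using 1
      field_simp
      ring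

end

/-- If `Δ < −11`, then the finite part `S_K°` of the Schmidt
arrangement of `K`, with the subspace topology from `ℂ`, has infinitely many connected
components. -/
theorem stmt17 (K : Type) [Field K] [NumberField K]
    (hdeg : Module.finrank ℚ K = 2) (hdisc : NumberField.discr K < -11)
    (ι : K →+* ℂ) :
    Infinite (ConnectedComponents (schmidtFin K ι)) := by
  obtain ⟨g, p, r, hr, hp, hpg⟩ := exists_ghost_circle hdeg hdisc ι
  refine infinite_connectedComponents_of_disk (fun z hz n => ?_) (fun z hz n h => ?_) hp hpg
  · exact_mod_cast add_intCast_mem_schmidtFin hz n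
  · refine hr _ (add_intCast_mem_schmidtFin hz (-n)) ?_
    rw [← h, dist_eq_norm, dist_eq_norm]
    congr 1
    push_cast
    ring
end
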